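/- arXiv:2101.03585 — 3 statements merged into one kernel-verified Lean document; each statement's English description precedes it below -/
import Mathlib

section
/- Let T be a bounded linear operator on a complex separable Hilbert space E. The following are equivalent: (i) T is norm-attaining; (ii) the adjoint T* is norm-attaining; (iii) TT* is norm-attaining; (iv) ‖T‖² is an eigenvalue of TT*. -/
noncomputable section

/-- A bounded operator attains its norm if `‖T f‖ = ‖T‖ * ‖f‖` for some nonzero `f`. -/
def NormAttaining {E F : Type*} [NormedAddCommGroup E] [NormedSpace ℂ E]
    [NormedAddCommGroup F] [NormedSpace ℂ F] (T : E →L[ℂ] F) : Prop :=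
  ∃ f : E, f ≠ 0 ∧ ‖T f‖ = ‖T‖ * ‖f‖

open ContinuousLinearMap in
theorem NA_eig {E : Type*} [NormedAddCommGroup E] [InnerProductSpace ℂ E] [CompleteSpace E]
    (T : E →L[ℂ] E) (f : E) (h : ‖T f‖ = ‖T‖ * ‖f‖) :
    adjoint T (T f) = ((‖T‖ : ℂ) ^ 2) • f := by
  have h1 : ‖adjoint T (T f)‖ ≤ ‖T‖ ^ 2 * ‖f‖ := by
    have := (adjoint T).le_opNorm (T f)
    rw [LinearIsometryEquiv.norm_map, h] at this
    linarith
  have h2 : RCLike.re (inner ℂ (adjoint T (T f)) (((‖T‖ : ℂ) ^ 2) • f))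
      = ‖T‖ ^ 2 * (‖T‖ * ‖f‖) ^ 2 := by
    rw [inner_smul_right, adjoint_inner_left, inner_self_eq_norm_sq_to_K, h]
    have : ((‖T‖ : ℂ) ^ 2) * ((‖T‖ * ‖f‖ : ℝ) : ℂ) ^ 2
        = ((‖T‖ ^ 2 * (‖T‖ * ‖f‖) ^ 2 : ℝ) : ℂ) := by push_cast; ring
    exact (congrArg Complex.re this).trans (Complex.ofReal_re _)
  have h3 : ‖((‖T‖ : ℂ) ^ 2) • f‖ = ‖T‖ ^ 2 * ‖f‖ := by
    rw [norm_smul]; simp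
  have h4 := norm_sub_sq (𝕜 := ℂ) (adjoint T (T f)) (((‖T‖ : ℂ) ^ 2) • f)
  rw [h2, h3] at h4
  have h5 : ‖adjoint T (T f)‖ ^ 2 ≤ (‖T‖ ^ 2 * ‖f‖) ^ 2 := by gcongr
  have h6 : ‖adjoint T (T f) - ((‖T‖ : ℂ) ^ 2) • f‖ ^ 2 = 0 :=
    le_antisymm (by nlinarith) (sq_nonneg _)
  exact sub_eq_zero.1 (norm_eq_zero.1 (pow_eq_zero_iff two_ne_zero |>.1 h6))

open ContinuousLinearMap in
theorem NA_adj {E : Type*} [NormedAddCommGroup E] [InnerProductSpace ℂ E] [CompleteSpace E]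
    (T : E →L[ℂ] E) (h : NormAttaining T) : NormAttaining (adjoint T) := by
  obtain ⟨f, hf, h⟩ := h
  by_cases hT : T = 0
  · exact ⟨f, hf, by simp [hT]⟩
  have hn : ‖T‖ ≠ 0 := norm_ne_zero_iff.2 hT
  refine ⟨T f, ?_, ?_⟩
  · rw [← norm_ne_zero_iff, h]
    exact mul_ne_zero hn (norm_ne_zero_iff.2 hf)
  · rw [NA_eig T f h, LinearIsometryEquiv.norm_map, h, norm_smul]
    simp
    ring

/-- For a bounded operator `T` on a complex separable Hilbert space, the following are
equivalent: (i) `T` is norm-attaining; (ii) `T*` is norm-attaining; (iii) `T T*` is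
norm-attaining; (iv) `‖T‖ ^ 2` is an eigenvalue of `T T*`. -/
theorem normAttaining_iff_adjoint_iff_self_comp_adjoint_iff_eigenvalue
    {E : Type*} [NormedAddCommGroup E] [InnerProductSpace ℂ E] [CompleteSpace E]
    [TopologicalSpace.SeparableSpace E] (T : E →L[ℂ] E) :
    (NormAttaining T ↔ NormAttaining (ContinuousLinearMap.adjoint T)) ∧
    (NormAttaining T ↔ NormAttaining (T ∘L ContinuousLinearMap.adjoint T)) ∧
    (NormAttaining T ↔
      Module.End.HasEigenvalue
        ((T ∘L ContinuousLinearMap.adjoint T : E →L[ℂ] E) : E →ₗ[ℂ] E)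
        ((‖T‖ : ℂ) ^ 2)) := by
  have hadj : NormAttaining T ↔ NormAttaining (ContinuousLinearMap.adjoint T) :=
    ⟨NA_adj T, fun h => by simpa using NA_adj _ h⟩
  have hnorm : ‖T ∘L ContinuousLinearMap.adjoint T‖ = ‖T‖ ^ 2 := by
    have := ContinuousLinearMap.norm_adjoint_comp_self (ContinuousLinearMap.adjoint T)
    rw [ContinuousLinearMap.adjoint_adjoint, LinearIsometryEquiv.norm_map] at this
    rw [this, sq]
  have h24 : NormAttaining (ContinuousLinearMap.adjoint T) →
      Module.End.HasEigenvalue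
        ((T ∘L ContinuousLinearMap.adjoint T : E →L[ℂ] E) : E →ₗ[ℂ] E)
        ((‖T‖ : ℂ) ^ 2) := by
    rintro ⟨f, hf, h⟩
    have := NA_eig _ f h
    rw [ContinuousLinearMap.adjoint_adjoint, LinearIsometryEquiv.norm_map] at this
    exact Module.End.hasEigenvalue_of_hasEigenvector
      (x := f) ⟨Module.End.mem_eigenspace_iff.2 this, hf⟩
  have h43 : Module.End.HasEigenvalue
        ((T ∘L ContinuousLinearMap.adjoint T : E →L[ℂ] E) : E →ₗ[ℂ] E)
        ((‖T‖ : ℂ) ^ 2) → NormAttaining (T ∘L ContinuousLinearMap.adjoint T) := by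
    intro h
    obtain ⟨f, hm, hf⟩ := h.exists_hasEigenvector
    have hm' : (T ∘L ContinuousLinearMap.adjoint T) f = ((‖T‖ : ℂ) ^ 2) • f :=
      Module.End.mem_eigenspace_iff.1 hm
    refine ⟨f, hf, ?_⟩
    rw [hnorm, hm', norm_smul]
    simp
  have h32 : NormAttaining (T ∘L ContinuousLinearMap.adjoint T) →
      NormAttaining (ContinuousLinearMap.adjoint T) := by
    rintro ⟨f, hf, h⟩
    refine ⟨f, hf, le_antisymm (ContinuousLinearMap.le_opNorm _ _) ?_⟩
    rw [LinearIsometryEquiv.norm_map]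
    by_cases hT : T = 0
    · simp [hT]
    have hn : 0 < ‖T‖ := norm_pos_iff.2 hT
    have h1 := T.le_opNorm (ContinuousLinearMap.adjoint T f)
    rw [hnorm, ContinuousLinearMap.comp_apply] at h
    rw [h] at h1
    exact le_of_mul_le_mul_left (by linarith) hn
  exact ⟨hadj, ⟨fun h => h43 (h24 (hadj.1 h)), fun h => hadj.2 (h32 h)⟩,
    ⟨fun h => h24 (hadj.1 h), fun h => hadj.2 (h32 (h43 h))⟩⟩

end
end

section
/- Define T : ℓ²(ℕ) → ℓ²(ℕ) (sequences indexed by n ≥ 1) by (Tα)₁ = α₁, (Tα)₂ = 0, and for every n ≥ 1: (Tα)₍₂ₙ₊₁₎ = α₍₂ₙ₊₁₎ and (Tα)₍₂ₙ₊₂₎ = (1 − 1/(2n+1))·α₍₂ₙ₊₁₎. Then T is a bounded idempotent operator (T² = T), ‖T‖ = √2, and T is not norm-attaining. -/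
noncomputable section

lemma hasSum_pairs (α : lp (fun _ : ℕ => ℂ) 2) :
    HasSum (fun n : ℕ => ‖α (2 * n)‖ ^ 2 + ‖α (2 * n + 1)‖ ^ 2) (‖α‖ ^ 2) := by
  have h : HasSum (fun k => ‖α k‖ ^ 2) (‖α‖ ^ 2) := by
    have := lp.hasSum_norm (p := 2) (by norm_num) α
    simpa using this
  have he : Summable (fun n : ℕ => ‖α (2 * n)‖ ^ 2) :=
    h.summable.comp_injective (i := fun n : ℕ => 2 * n) (fun a b hab => by simpa using hab)
  have ho : Summable (fun n : ℕ => ‖α (2 * n + 1)‖ ^ 2) :=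
    h.summable.comp_injective (i := fun n : ℕ => 2 * n + 1) (fun a b hab => by simpa using hab)
  have h2 := HasSum.even_add_odd (f := fun k => ‖α k‖ ^ 2) he.hasSum ho.hasSum
  have h3 := he.hasSum.add ho.hasSum
  rwa [h2.unique h] at h3

def coef (n : ℕ) : ℝ := 1 - 1 / (2 * (n : ℝ) + 1)

lemma coef_nonneg (n : ℕ) : 0 ≤ coef n := by
  unfold coef
  rw [sub_nonneg, div_le_one (by positivity)]
  have : (0 : ℝ) ≤ n := by positivity
  linarith

lemma coef_lt (n : ℕ) : coef n < 1 := by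
  unfold coef
  have : (0 : ℝ) < 1 / (2 * (n : ℝ) + 1) := by positivity
  linarith

lemma coef_sq_lt (n : ℕ) : coef n ^ 2 < 1 := by
  nlinarith [coef_nonneg n, coef_lt n]

lemma coef_cast (n : ℕ) : ((coef n : ℝ) : ℂ) = 1 - 1 / (2 * (n : ℂ) + 1) := by
  unfold coef; push_cast; rfl

def seqT (α : ℕ → ℂ) (k : ℕ) : ℂ :=
  if k % 2 = 0 then α k else (coef (k / 2) : ℂ) * α (2 * (k / 2))

lemma seqT_even (α : ℕ → ℂ) (n : ℕ) : seqT α (2 * n) = α (2 * n) := by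
  simp [seqT]

lemma seqT_odd (α : ℕ → ℂ) (n : ℕ) : seqT α (2 * n + 1) = (coef n : ℂ) * α (2 * n) := by
  have h1 : (2 * n + 1) % 2 = 1 := by omega
  have h2 : (2 * n + 1) / 2 = n := by omega
  simp [seqT, h1, h2]

lemma norm_odd (n : ℕ) (z : ℂ) : ‖(coef n : ℂ) * z‖ ^ 2 = coef n ^ 2 * ‖z‖ ^ 2 := by
  rw [norm_mul, Complex.norm_real, mul_pow, Real.norm_eq_abs, sq_abs]

lemma memT (α : lp (fun _ : ℕ => ℂ) 2) : Memℓp (E := fun _ : ℕ => ℂ) (seqT α) 2 := by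
  apply memℓp_gen
  have h : Summable (fun k => ‖α k‖ ^ 2) := by
    have := lp.hasSum_norm (p := 2) (by norm_num) α
    simpa using this.summable
  have he : Summable (fun n : ℕ => ‖α (2 * n)‖ ^ 2) :=
    h.comp_injective (i := fun n : ℕ => 2 * n) (fun a b hab => by simpa using hab)
  have ho : Summable (fun n : ℕ => coef n ^ 2 * ‖α (2 * n)‖ ^ 2) :=
    Summable.of_nonneg_of_le (fun n => by positivity)
      (fun n => mul_le_of_le_one_left (by positivity) (coef_sq_lt n).le) he
  have h2 := HasSum.even_add_odd (f := fun k => ‖seqT α k‖ ^ 2)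
    (by simpa only [seqT_even] using he.hasSum)
    (by simpa only [seqT_odd, norm_odd] using ho.hasSum)
  simpa using h2.summable

def linT : lp (fun _ : ℕ => ℂ) 2 →ₗ[ℂ] lp (fun _ : ℕ => ℂ) 2 where
  toFun α := ⟨seqT α, memT α⟩
  map_add' α β := by
    ext k
    change seqT (α + β : lp (fun _ : ℕ => ℂ) 2) k = seqT α k + seqT β k
    simp only [seqT, lp.coeFn_add, Pi.add_apply]
    split_ifs <;> ring
  map_smul' c α := by
    ext k
    change seqT (c • α : lp (fun _ : ℕ => ℂ) 2) k = c * seqT α k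
    simp only [seqT, lp.coeFn_smul, Pi.smul_apply, smul_eq_mul]
    split_ifs <;> ring

lemma linT_apply (α : lp (fun _ : ℕ => ℂ) 2) (k : ℕ) : linT α k = seqT α k := rfl

lemma hasSum_linT (α : lp (fun _ : ℕ => ℂ) 2) :
    HasSum (fun n : ℕ => ‖α (2 * n)‖ ^ 2 + coef n ^ 2 * ‖α (2 * n)‖ ^ 2) (‖linT α‖ ^ 2) := by
  simpa only [linT_apply, seqT_even, seqT_odd, norm_odd] using hasSum_pairs (linT α)

lemma term_le (α : lp (fun _ : ℕ => ℂ) 2) (n : ℕ) :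
    ‖α (2 * n)‖ ^ 2 + coef n ^ 2 * ‖α (2 * n)‖ ^ 2
      ≤ 2 * (‖α (2 * n)‖ ^ 2 + ‖α (2 * n + 1)‖ ^ 2) := by
  have := mul_le_of_le_one_left (sq_nonneg ‖α (2 * n)‖) (coef_sq_lt n).le
  nlinarith [sq_nonneg ‖α (2 * n + 1)‖]

lemma linT_bound (α : lp (fun _ : ℕ => ℂ) 2) : ‖linT α‖ ≤ Real.sqrt 2 * ‖α‖ := by
  have h := hasSum_le (term_le α) (hasSum_linT α) ((hasSum_pairs α).mul_left 2)
  refine (sq_le_sq₀ (norm_nonneg _) (by positivity)).1 ?_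
  rw [mul_pow, Real.sq_sqrt (by norm_num)]
  exact h

lemma linT_lt (α : lp (fun _ : ℕ => ℂ) 2) (hα : α ≠ 0) : ‖linT α‖ ^ 2 < 2 * ‖α‖ ^ 2 := by
  obtain ⟨k, hk⟩ : ∃ k, α k ≠ 0 := by
    by_contra! hc
    exact hα (by ext k; simpa using hc k)
  refine hasSum_lt (i := k / 2) (term_le α) ?_ (hasSum_linT α) ((hasSum_pairs α).mul_left 2)
  have h1 := mul_le_of_le_one_left (sq_nonneg ‖α (2 * (k / 2))‖) (coef_sq_lt (k / 2)).le
  rcases Nat.even_or_odd' k with ⟨m, rfl | rfl⟩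
  · have e : 2 * m / 2 = m := by omega
    rw [e]
    have hp : 0 < ‖α (2 * m)‖ ^ 2 := by positivity
    have := mul_lt_of_lt_one_left hp (coef_sq_lt m)
    nlinarith [sq_nonneg ‖α (2 * m + 1)‖]
  · have e : (2 * m + 1) / 2 = m := by omega
    rw [e] at h1 ⊢
    have hp : 0 < ‖α (2 * m + 1)‖ ^ 2 := by positivity
    nlinarith [sq_nonneg ‖α (2 * m)‖]

lemma coef_tendsto : Filter.Tendsto coef Filter.atTop (nhds 1) := by
  have h := (tendsto_one_div_add_atTop_nhds_zero_nat (𝕜 := ℝ)).comp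
    (Filter.tendsto_id.const_mul_atTop' (r := 2) (by norm_num))
  have h2 := h.const_sub 1
  rw [sub_zero] at h2
  refine h2.congr fun n => ?_
  simp [coef]

lemma linT_single (n : ℕ) : 1 + coef n ^ 2 ≤ ‖linT (lp.single 2 (2 * n) (1 : ℂ))‖ ^ 2 := by
  have h := hasSum_linT (lp.single 2 (2 * n) (1 : ℂ))
  have := le_hasSum h n (fun j _ => by positivity)
  simpa using this

/-- There is a bounded operator `T` on `ℓ²(ℕ)` (here sequences are indexed starting at `0`,
so the Lean index `k` corresponds to the paper's index `k + 1`) given by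
`(Tα)_{2n+1} = α_{2n+1}`, `(Tα)_{2n+2} = (1 - 1/(2n+1)) α_{2n+1}` (in the paper's indexing,
including the degenerate first pair `(Tα)₁ = α₁`, `(Tα)₂ = 0`), and `T` is idempotent,
has norm `√2`, and is not norm-attaining. -/
theorem exists_idempotent_norm_sqrt_two_not_normAttaining :
    ∃ T : lp (fun _ : ℕ => ℂ) 2 →L[ℂ] lp (fun _ : ℕ => ℂ) 2,
      (∀ (α : lp (fun _ : ℕ => ℂ) 2) (n : ℕ),
        T α (2 * n) = α (2 * n) ∧
        T α (2 * n + 1) = (1 - 1 / (2 * (n : ℂ) + 1)) * α (2 * n)) ∧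
      T ∘L T = T ∧ ‖T‖ = Real.sqrt 2 ∧ ¬ NormAttaining T := by
  have key : ∀ α, (linT.mkContinuous (Real.sqrt 2) linT_bound) α = linT α := fun _ => rfl
  have hle : ‖linT.mkContinuous (Real.sqrt 2) linT_bound‖ ≤ Real.sqrt 2 :=
    LinearMap.mkContinuous_norm_le _ (by positivity) _
  have hge : Real.sqrt 2 ≤ ‖linT.mkContinuous (Real.sqrt 2) linT_bound‖ := by
    apply Real.sqrt_le_iff.2 ⟨norm_nonneg _, ?_⟩
    have hlim : Filter.Tendsto (fun n => 1 + coef n ^ 2) Filter.atTop (nhds 2) := by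
      have := (coef_tendsto.pow 2).const_add 1
      norm_num at this
      exact this
    refine le_of_tendsto' hlim fun n => (linT_single n).trans ?_
    have h1 := (linT.mkContinuous (Real.sqrt 2) linT_bound).le_opNorm
      (lp.single 2 (2 * n) (1 : ℂ))
    rw [lp.norm_single (by norm_num), norm_one, mul_one, key] at h1
    gcongr
  have hnorm := le_antisymm hle hge
  refine ⟨linT.mkContinuous (Real.sqrt 2) linT_bound, ?_, ?_, hnorm, ?_⟩
  · intro α n
    rw [key, linT_apply, linT_apply, seqT_even, seqT_odd, coef_cast]
    exact ⟨rfl, rfl⟩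
  · ext α k
    change seqT (seqT α) k = seqT α k
    rcases Nat.even_or_odd' k with ⟨m, rfl | rfl⟩
    · simp only [seqT_even]
    · simp only [seqT_odd, seqT_even]
  · rintro ⟨f, hf, h⟩
    rw [hnorm, key] at h
    have h2 := linT_lt f hf
    rw [h, mul_pow, Real.sq_sqrt (by norm_num)] at h2
    exact lt_irrefl _ h2

end
end

section
/- Let T be a bounded idempotent operator (T² = T) on a complex Hilbert space E. Then T is norm-attaining if and only if the self-adjoint operator T + T* − I is norm-attaining. -/
noncomputable section

open ContinuousLinearMap in
lemma idem_decomp {E : Type*} [NormedAddCommGroup E] [InnerProductSpace ℂ E] [CompleteSpace E]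
    (T : E →L[ℂ] E) (h : ∀ x, T (T x) = T x) (f : E) :
    ∃ a b : E, f = a + b ∧ T a = a ∧ adjoint T b = 0 ∧ inner ℂ a b = 0 := by
  let K : Submodule ℂ E := LinearMap.ker ((1 - T : E →L[ℂ] E) : E →ₗ[ℂ] E)
  have hK : IsClosed (K : Set E) := (1 - T : E →L[ℂ] E).isClosed_ker
  have : CompleteSpace K := hK.completeSpace_coe
  have hmem : ∀ x, x ∈ K ↔ T x = x := by
    intro x
    simp only [K, LinearMap.mem_ker, ContinuousLinearMap.coe_coe, sub_apply, one_apply_eq_self,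
      sub_eq_zero]
    exact eq_comm
  obtain ⟨a, ha, b, hb, hf⟩ := K.exists_add_mem_mem_orthogonal f
  refine ⟨a, b, hf, (hmem a).1 ha, ?_, (K.mem_orthogonal b).1 hb a ha⟩
  refine ext_inner_left ℂ fun x => ?_
  rw [adjoint_inner_right, inner_zero_right]
  exact (K.mem_orthogonal b).1 hb _ ((hmem _).2 (h x))

lemma idem_pythag {E : Type*} [NormedAddCommGroup E] [InnerProductSpace ℂ E]
    (x y : E) (h : inner ℂ x y = 0) : ‖x + y‖ ^ 2 = ‖x‖ ^ 2 + ‖y‖ ^ 2 := by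
  have := norm_add_sq_eq_norm_sq_add_norm_sq_of_inner_eq_zero x y h
  nlinarith

lemma idem_inner_self {E : Type*} [NormedAddCommGroup E] [InnerProductSpace ℂ E]
    (x : E) : inner ℂ x x = ((‖x‖ ^ 2 : ℝ) : ℂ) := by
  rw [inner_self_eq_norm_sq_to_K, Complex.ofReal_pow]
  rfl

lemma idem_real (t x y : ℝ) (ht : 1 ≤ t) (hx : 0 ≤ x)
    (h : ∀ c : ℝ, (c + 1) ^ 2 * x ≤ t ^ 2 * (c ^ 2 * x + y)) : x + y ≤ t ^ 2 * y := by
  rcases ht.eq_or_lt with rfl | ht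
  · by_contra hc
    have hx : 0 < x := by linarith
    have := h (y / x)
    have e : y / x * x = y := by field_simp
    have := h 0
    nlinarith
  · have hs : 0 < t ^ 2 - 1 := by nlinarith
    have h1 := h (1 / (t ^ 2 - 1))
    have h2 := mul_le_mul_of_nonneg_left h1 (sq_nonneg (t ^ 2 - 1))
    have e1 : (t ^ 2 - 1) ^ 2 * ((1 / (t ^ 2 - 1) + 1) ^ 2 * x) = t ^ 4 * x := by
      field_simp
      ring
    have e2 : (t ^ 2 - 1) ^ 2 * (t ^ 2 * ((1 / (t ^ 2 - 1)) ^ 2 * x + y))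
        = t ^ 2 * (x + (t ^ 2 - 1) ^ 2 * y) := by
      field_simp
    rw [e1, e2] at h2
    have h3 : 0 ≤ (t ^ 2 * (t ^ 2 - 1)) * ((t ^ 2 - 1) * y - x) := by nlinarith
    have := nonneg_of_mul_nonneg_right h3 (by positivity)
    linarith

open ContinuousLinearMap in
lemma idem_norm_le {E : Type*} [NormedAddCommGroup E] [InnerProductSpace ℂ E] [CompleteSpace E]
    (T : E →L[ℂ] E) (h : ∀ x, T (T x) = T x) (ht : 1 ≤ ‖T‖) :
    ‖T + adjoint T - 1‖ ≤ ‖T‖ := by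
  refine opNorm_le_bound _ (norm_nonneg _) fun f => ?_
  obtain ⟨a, b, rfl, ha, hb, hab⟩ := idem_decomp T h f
  have hort : ∀ x, inner ℂ (T x) b = 0 := fun x => by
    rw [← adjoint_inner_right, hb, inner_zero_right]
  have hB : (T + adjoint T - 1) (a + b) = adjoint T a + (T b - b) := by
    simp only [sub_apply, add_apply, one_apply_eq_self, map_add, ha, hb]
    abel
  have h1 : ‖adjoint T a + (T b - b)‖ ^ 2 = ‖adjoint T a‖ ^ 2 + ‖T b - b‖ ^ 2 := by
    apply idem_pythag
    rw [adjoint_inner_left, map_sub, h, sub_self, inner_zero_right]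
  have h2 : ‖T b - b‖ ^ 2 = ‖T b‖ ^ 2 + ‖b‖ ^ 2 := by
    rw [sub_eq_add_neg, idem_pythag, norm_neg]
    rw [inner_neg_right, hort, neg_zero]
  have h3 : ‖adjoint T a‖ ≤ ‖T‖ * ‖a‖ := by
    simpa using (adjoint T).le_opNorm a
  have h4 : ‖T b‖ ^ 2 + ‖b‖ ^ 2 ≤ ‖T‖ ^ 2 * ‖b‖ ^ 2 := by
    apply idem_real _ _ _ ht (sq_nonneg _)
    intro c
    have k1 := T.le_opNorm ((c : ℂ) • T b + b)
    have k2 : T ((c : ℂ) • T b + b) = ((c + 1 : ℝ) : ℂ) • T b := by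
      rw [map_add, map_smul, h]
      push_cast
      rw [add_smul, one_smul]
    have k3 : ‖(c : ℂ) • T b + b‖ ^ 2 = c ^ 2 * ‖T b‖ ^ 2 + ‖b‖ ^ 2 := by
      rw [idem_pythag, norm_smul, mul_pow, Complex.norm_real, Real.norm_eq_abs, sq_abs]
      rw [inner_smul_left, hort, mul_zero]
    have k4 := pow_le_pow_left₀ (norm_nonneg _) k1 2
    rw [mul_pow, k3, k2, norm_smul, mul_pow, Complex.norm_real, Real.norm_eq_abs, sq_abs] at k4
    exact k4
  have h5 := pow_le_pow_left₀ (norm_nonneg _) h3 2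
  refine le_of_sq_le_sq ?_ (by positivity)
  rw [hB, h1, h2, mul_pow, idem_pythag a b hab]
  nlinarith

open ContinuousLinearMap in
lemma idem_attain_sq {E : Type*} [NormedAddCommGroup E] [InnerProductSpace ℂ E] [CompleteSpace E]
    (T : E →L[ℂ] E) (f : E) (h : ‖T f‖ = ‖T‖ * ‖f‖) :
    adjoint T (T f) = ((‖T‖ ^ 2 : ℝ) : ℂ) • f := by
  have h1 : ‖adjoint T (T f)‖ ≤ ‖T‖ * (‖T‖ * ‖f‖) := by
    have := (adjoint T).le_opNorm (T f)
    rw [h] at this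
    simpa using this
  have h2 : RCLike.re (inner ℂ (adjoint T (T f)) (((‖T‖ ^ 2 : ℝ) : ℂ) • f))
      = ‖T‖ ^ 2 * ‖T f‖ ^ 2 := by
    rw [inner_smul_right, adjoint_inner_left, idem_inner_self, ← Complex.ofReal_mul]
    exact Complex.ofReal_re _
  have h3 := @norm_sub_sq ℂ E _ _ _ (adjoint T (T f)) (((‖T‖ ^ 2 : ℝ) : ℂ) • f)
  rw [h2, norm_smul, Complex.norm_real, Real.norm_eq_abs, abs_of_nonneg (sq_nonneg _), h] at h3
  have h4 := pow_le_pow_left₀ (norm_nonneg _) h1 2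
  rw [← sub_eq_zero, ← norm_eq_zero, ← sq_eq_zero_iff]
  refine le_antisymm ?_ (sq_nonneg _)
  rw [h3]
  nlinarith

/-- A bounded idempotent operator `T` on a complex Hilbert space is norm-attaining if and
only if the Buckholtz operator `T + T* - I` is norm-attaining. -/
theorem idempotent_normAttaining_iff_buckholtz
    {E : Type*} [NormedAddCommGroup E] [InnerProductSpace ℂ E] [CompleteSpace E]
    (T : E →L[ℂ] E) (hT : T ∘L T = T) :
    NormAttaining T ↔ NormAttaining (T + ContinuousLinearMap.adjoint T - 1) := by
  have h : ∀ x, T (T x) = T x := fun x => DFunLike.congr_fun hT x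
  by_cases hT0 : T = 0
  · subst hT0
    have e : (0 + ContinuousLinearMap.adjoint 0 - 1 : E →L[ℂ] E) = -1 := by simp
    rw [e]
    constructor
    · rintro ⟨f, hf, -⟩
      have : Nontrivial E := ⟨f, 0, hf⟩
      exact ⟨f, hf, by simp⟩
    · rintro ⟨f, hf, -⟩
      exact ⟨f, hf, by simp⟩
  obtain ⟨z, hz⟩ : ∃ z, T z ≠ 0 := by
    by_contra! hc
    exact hT0 (ContinuousLinearMap.ext hc)
  have ht : 1 ≤ ‖T‖ := by
    have h1 := T.le_opNorm (T z)
    rw [h] at h1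
    have := norm_pos_iff.2 hz
    exact (le_mul_iff_one_le_left this).1 h1
  have hBle := idem_norm_le T h ht
  have ha : ∀ x, ContinuousLinearMap.adjoint T (ContinuousLinearMap.adjoint T x)
      = ContinuousLinearMap.adjoint T x := fun x => by
    refine ext_inner_left ℂ fun y => ?_
    simp only [ContinuousLinearMap.adjoint_inner_right, h]
  have hsa : ContinuousLinearMap.adjoint (T + ContinuousLinearMap.adjoint T - 1)
      = T + ContinuousLinearMap.adjoint T - 1 := by
    have : ContinuousLinearMap.adjoint (1 : E →L[ℂ] E) = 1 := ContinuousLinearMap.adjoint_id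
    rw [map_sub, map_add, ContinuousLinearMap.adjoint_adjoint, this]
    abel
  have hBx : ∀ x, (T + ContinuousLinearMap.adjoint T - 1) x
      = T x + ContinuousLinearMap.adjoint T x - x := fun x => rfl
  have hBT : ∀ x, (T + ContinuousLinearMap.adjoint T - 1) (T x)
      = ContinuousLinearMap.adjoint T (T x) := fun x => by
    rw [hBx, h]; abel
  have hTB : ∀ x, T ((T + ContinuousLinearMap.adjoint T - 1) x)
      = T (ContinuousLinearMap.adjoint T x) := fun x => by
    rw [hBx, map_sub, map_add, h]; abel
  have hSB : ∀ x, ContinuousLinearMap.adjoint T ((T + ContinuousLinearMap.adjoint T - 1) x)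
      = ContinuousLinearMap.adjoint T (T x) := fun x => by
    rw [hBx, map_sub, map_add, ha]; abel
  have hnorm : ‖T + ContinuousLinearMap.adjoint T - 1‖ = ‖T‖ := by
    refine le_antisymm hBle ?_
    have e : (T + ContinuousLinearMap.adjoint T - 1) ∘L T = ContinuousLinearMap.adjoint T ∘L T :=
      ContinuousLinearMap.ext hBT
    have h1 := (T + ContinuousLinearMap.adjoint T - 1).opNorm_comp_le T
    rw [e, ContinuousLinearMap.norm_adjoint_comp_self] at h1
    exact le_of_mul_le_mul_right h1 (by linarith)
  generalize (T + ContinuousLinearMap.adjoint T - 1) = B at *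
  constructor
  · rintro ⟨f, hf, hfT⟩
    have h1 := idem_attain_sq T f hfT
    have hfp := norm_pos_iff.2 hf
    refine ⟨T f, ?_, ?_⟩
    · rw [← norm_pos_iff, hfT]; positivity
    · rw [hBT, h1, norm_smul, hnorm, hfT, Complex.norm_real, Real.norm_eq_abs,
        abs_of_nonneg (sq_nonneg _)]
      ring
  · rintro ⟨f, hf, hfB⟩
    have h1 := idem_attain_sq B f hfB
    rw [hsa, hnorm] at h1
    by_cases h0 : T f = 0 ∧ ContinuousLinearMap.adjoint T f = 0
    · have h2 : ‖T‖ = 1 := by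
        rw [hBx, h0.1, h0.2, hnorm, add_zero, zero_sub, norm_neg] at hfB
        have := norm_pos_iff.2 hf
        exact (mul_eq_right₀ this.ne').1 hfB.symm
      exact ⟨T z, hz, by rw [h, h2, one_mul]⟩
    -- an eigenvector of the adjoint product attains the norm
    have key : ∀ u : E, u ≠ 0 →
        ContinuousLinearMap.adjoint T (T u) = ((‖T‖ ^ 2 : ℝ) : ℂ) • u → NormAttaining T := by
      intro u hu hh
      refine ⟨u, hu, ?_⟩
      have h3 : ‖T u‖ ^ 2 = ‖T‖ ^ 2 * ‖u‖ ^ 2 := by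
        have h4 : inner ℂ (T u) (T u) = inner ℂ u (((‖T‖ ^ 2 : ℝ) : ℂ) • u) := by
          rw [← hh, ContinuousLinearMap.adjoint_inner_right]
        rw [inner_smul_right, idem_inner_self, idem_inner_self] at h4
        exact_mod_cast h4
      rw [← mul_pow] at h3
      exact (sq_eq_sq₀ (norm_nonneg _) (by positivity)).1 h3
    by_cases hS : ContinuousLinearMap.adjoint T f = 0
    · have hTf : T f ≠ 0 := fun hc => h0 ⟨hc, hS⟩
      -- T T* (T f) = t^2 T f
      have h2 : T (ContinuousLinearMap.adjoint T (T f)) = ((‖T‖ ^ 2 : ℝ) : ℂ) • T f := by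
        rw [← map_smul, ← h1, hTB, hBx, map_sub, map_add, hS, map_zero, sub_zero, add_zero]
      refine key (ContinuousLinearMap.adjoint T (T f)) ?_ ?_
      · intro hc
        rw [hc, map_zero] at h2
        have ht2 : ((‖T‖ ^ 2 : ℝ) : ℂ) ≠ 0 := by
          have : ‖T‖ ^ 2 ≠ 0 := by positivity
          exact_mod_cast this
        exact (smul_ne_zero ht2 hTf) h2.symm
      · rw [h2, map_smul]
    · refine key _ hS ?_
      rw [← map_smul, ← h1, hSB, hTB]

end
end
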